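/- Assume 1 < k < 2, and let x_c be the unique zero of H' in (0, Λ₀/(1+η)). Then: (a) if R₀ < 1 and H(x_c) = 0, then x_c is the unique zero of H in (0, Λ₀/(1+η)]; (b) if R₀ < 1 and H(x_c) > 0, then H has exactly two zeros x̄₁* < x̄₂* in (0, Λ₀/(1+η)), with x̄₁* < x_c < x̄₂*, H'(x̄₁*) > 0 and H'(x̄₂*) < 0; (c) if R₀ ≥ 1, then H has exactly one zero in (0, Λ₀/(1+η)), and it lies in (x_c, Λ₀/(1+η)). -/

import Mathlib

/-- The function `H(x) = (1+p·x^(k−1))·(1 − (1+η)x/Λ₀) − γ/Λ₀`. -/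
noncomputable def Hfun (p Λ₀ γ η k : ℝ) (x : ℝ) : ℝ :=
  (1 + p * x ^ (k - 1)) * (1 - (1 + η) * x / Λ₀) - γ / Λ₀

theorem Hfun_hasDerivAt (p Λ₀ γ η k x : ℝ) (hx : 0 < x) :
    HasDerivAt (Hfun p Λ₀ γ η k)
      (p * (k - 1) * x ^ (k - 2) - p * k * ((1 + η) / Λ₀) * x ^ (k - 1) - (1 + η) / Λ₀) x := by
  have h1 : HasDerivAt (fun y : ℝ => y ^ (k - 1)) ((k - 1) * x ^ (k - 1 - 1)) x :=
    Real.hasDerivAt_rpow_const (Or.inl hx.ne')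
  have h2 : HasDerivAt (fun y : ℝ => 1 + p * y ^ (k - 1)) (p * ((k - 1) * x ^ (k - 1 - 1))) x :=
    (h1.const_mul p).const_add 1
  have h3 : HasDerivAt (fun y : ℝ => 1 - (1 + η) * y / Λ₀) (-((1 + η) * 1 / Λ₀)) x :=
    (((hasDerivAt_id x).const_mul (1 + η)).div_const Λ₀).const_sub 1
  have h4 := (h2.mul h3).sub_const (γ / Λ₀)
  have e : k - 1 - 1 = k - 2 := by ring
  have e2 : x ^ (k - 1) = x ^ (k - 2) * x := by
    rw [← Real.rpow_add_one hx.ne']; congr 1; ring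
  rw [e] at h4
  refine h4.congr_deriv ?_
  rw [e2]
  ring

theorem Hfun_deriv_anti (p Λ₀ γ η k : ℝ) (hp : 0 < p) (hΛ : 0 < Λ₀) (hη : 0 < η)
    (hk1 : 1 < k) (hk2 : k < 2) (x y : ℝ) (hx : 0 < x) (hxy : x < y) :
    deriv (Hfun p Λ₀ γ η k) y < deriv (Hfun p Λ₀ γ η k) x := by
  rw [(Hfun_hasDerivAt p Λ₀ γ η k x hx).deriv,
    (Hfun_hasDerivAt p Λ₀ γ η k y (hx.trans hxy)).deriv]
  have h1 : y ^ (k - 2) < x ^ (k - 2) := Real.rpow_lt_rpow_of_neg hx hxy (by linarith)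
  have h2 : x ^ (k - 1) < y ^ (k - 1) := Real.rpow_lt_rpow hx.le hxy (by linarith)
  have h3 : 0 < p * (k - 1) := mul_pos hp (by linarith)
  have h4 : 0 < p * k * ((1 + η) / Λ₀) := by positivity
  have h5 := mul_lt_mul_of_pos_left h1 h3
  have h6 := mul_lt_mul_of_pos_left h2 h4
  linarith

/-- For `1 < k < 2` and `x_c` the unique zero of `H'` in `(0, Λ₀/(1+η))`:
(a) if `R₀ < 1` and `H(x_c) = 0`, then `x_c` is the unique zero of `H` in `(0, Λ₀/(1+η)]`;
(b) if `R₀ < 1` and `H(x_c) > 0`, then `H` has exactly two zeros `x̄₁* < x_c < x̄₂*` in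
`(0, Λ₀/(1+η))` with `H'(x̄₁*) > 0` and `H'(x̄₂*) < 0`;
(c) if `R₀ ≥ 1`, then `H` has exactly one zero in `(0, Λ₀/(1+η))`, lying in `(x_c, Λ₀/(1+η))`. -/
theorem H_zeros_of_one_lt_k_lt_two
    (p Λ₀ γ η k xc : ℝ)
    (hp : 0 < p) (hΛ : 0 < Λ₀) (hη : 0 < η) (hγη : η < γ)
    (hk1 : 1 < k) (hk2 : k < 2)
    (hxc : xc ∈ Set.Ioo (0 : ℝ) (Λ₀ / (1 + η)))
    (hxc0 : deriv (Hfun p Λ₀ γ η k) xc = 0)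
    (hxcuniq : ∀ x ∈ Set.Ioo (0 : ℝ) (Λ₀ / (1 + η)), deriv (Hfun p Λ₀ γ η k) x = 0 → x = xc) :
    (Λ₀ / γ < 1 → Hfun p Λ₀ γ η k xc = 0 →
      ∀ x ∈ Set.Ioc (0 : ℝ) (Λ₀ / (1 + η)), Hfun p Λ₀ γ η k x = 0 → x = xc) ∧
    (Λ₀ / γ < 1 → 0 < Hfun p Λ₀ γ η k xc →
      ∃ x₁ x₂ : ℝ, x₁ ∈ Set.Ioo (0 : ℝ) (Λ₀ / (1 + η)) ∧ x₂ ∈ Set.Ioo (0 : ℝ) (Λ₀ / (1 + η)) ∧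
        x₁ < xc ∧ xc < x₂ ∧
        Hfun p Λ₀ γ η k x₁ = 0 ∧ Hfun p Λ₀ γ η k x₂ = 0 ∧
        0 < deriv (Hfun p Λ₀ γ η k) x₁ ∧ deriv (Hfun p Λ₀ γ η k) x₂ < 0 ∧
        (∀ x ∈ Set.Ioo (0 : ℝ) (Λ₀ / (1 + η)), Hfun p Λ₀ γ η k x = 0 → x = x₁ ∨ x = x₂)) ∧
    (1 ≤ Λ₀ / γ →
      ∃ x₀ : ℝ, x₀ ∈ Set.Ioo xc (Λ₀ / (1 + η)) ∧ Hfun p Λ₀ γ η k x₀ = 0 ∧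
        ∀ x ∈ Set.Ioo (0 : ℝ) (Λ₀ / (1 + η)), Hfun p Λ₀ γ η k x = 0 → x = x₀) := by
  obtain ⟨hc0, hcb⟩ := hxc
  have hγ : 0 < γ := hη.trans hγη
  set b := Λ₀ / (1 + η) with hb
  have hanti := Hfun_deriv_anti p Λ₀ γ η k hp hΛ hη hk1 hk2
  have hpos : ∀ x, 0 < x → x < xc → 0 < deriv (Hfun p Λ₀ γ η k) x := fun x h0 h => by
    have := hanti x xc h0 h
    rwa [hxc0] at this
  have hneg : ∀ x, xc < x → deriv (Hfun p Λ₀ γ η k) x < 0 := fun x h => by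
    have := hanti xc x hc0 h
    rwa [hxc0] at this
  have hcont : Continuous (Hfun p Λ₀ γ η k) := by
    have h1 : Continuous (fun y : ℝ => y ^ (k - 1)) :=
      Real.continuous_rpow_const (by linarith)
    unfold Hfun
    fun_prop
  have H0 : Hfun p Λ₀ γ η k 0 = 1 - γ / Λ₀ := by
    unfold Hfun
    rw [Real.zero_rpow (by linarith)]
    simp
  have Hb : Hfun p Λ₀ γ η k b < 0 := by
    have e : (1 + η) * b / Λ₀ = 1 := by
      rw [hb]; field_simp
    have : 0 < γ / Λ₀ := by positivity
    unfold Hfun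
    rw [e]
    linarith
  generalize Hfun p Λ₀ γ η k = f at *
  have hmono : StrictMonoOn f (Set.Icc 0 xc) := by
    refine strictMonoOn_of_deriv_pos (convex_Icc _ _) hcont.continuousOn fun x hx => ?_
    rw [interior_Icc] at hx
    exact hpos x hx.1 hx.2
  have hdec : StrictAntiOn f (Set.Icc xc b) := by
    refine strictAntiOn_of_deriv_neg (convex_Icc _ _) hcont.continuousOn fun x hx => ?_
    rw [interior_Icc] at hx
    exact hneg x hx.1
  have hright : 0 < f xc → ∃ x₂, xc < x₂ ∧ x₂ < b ∧ f x₂ = 0 := fun h => by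
    obtain ⟨x, hx, hfx⟩ := intermediate_value_Ioo' hcb.le hcont.continuousOn ⟨Hb, h⟩
    exact ⟨x, hx.1, hx.2, hfx⟩
  refine ⟨fun _ hz x hx hfx => ?_, fun hR hz => ?_, fun hR => ?_⟩
  · rcases le_total x xc with h | h
    · exact hmono.injOn ⟨hx.1.le, h⟩ ⟨hc0.le, le_rfl⟩ (hfx.trans hz.symm)
    · exact hdec.injOn ⟨h, hx.2⟩ ⟨le_rfl, hcb.le⟩ (hfx.trans hz.symm)
  · have h0 : f 0 < 0 := by
      rw [div_lt_one hγ] at hR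
      have := (one_lt_div hΛ).2 hR
      linarith
    obtain ⟨x₂, h2c, h2b, hf2⟩ := hright hz
    obtain ⟨x₁, ⟨h10, h1c⟩, hf1⟩ := intermediate_value_Ioo hc0.le hcont.continuousOn ⟨h0, hz⟩
    refine ⟨x₁, x₂, ⟨h10, h1c.trans hcb⟩, ⟨hc0.trans h2c, h2b⟩, h1c, h2c, hf1, hf2,
      hpos _ h10 h1c, hneg _ h2c, fun x hx hfx => ?_⟩
    rcases le_total x xc with h | h
    · exact Or.inl (hmono.injOn ⟨hx.1.le, h⟩ ⟨h10.le, h1c.le⟩ (hfx.trans hf1.symm))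
    · exact Or.inr (hdec.injOn ⟨h, hx.2.le⟩ ⟨h2c.le, h2b.le⟩ (hfx.trans hf2.symm))
  · have h0 : 0 ≤ f 0 := by
      rw [le_div_iff₀ hγ, one_mul] at hR
      have := (div_le_one hΛ).2 hR
      linarith
    have hlt : ∀ x, 0 < x → x ≤ xc → 0 < f x := fun x hx h =>
      h0.trans_lt (hmono ⟨le_rfl, hc0.le⟩ ⟨hx.le, h⟩ hx)
    obtain ⟨x₂, h2c, h2b, hf2⟩ := hright (hlt xc hc0 le_rfl)
    refine ⟨x₂, ⟨h2c, h2b⟩, hf2, fun x hx hfx => ?_⟩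
    rcases le_total x xc with h | h
    · exact absurd hfx (hlt x hx.1 h).ne'
    · exact hdec.injOn ⟨h, hx.2.le⟩ ⟨h2c.le, h2b.le⟩ (hfx.trans hf2.symm)
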